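/- Assume ω₁ < 𝔟, i.e., every subset B ⊆ ω^ω of cardinality at most ℵ₁ is dominated by a countable set: there exists a countable C ⊆ ω^ω such that every f ∈ B satisfies f ≤ g for some g ∈ C. Let X be a completely regular Hausdorff space whose finest compatible uniformity has a 𝔊-base, i.e., there is a uniformity 𝒰 on X inducing the topology of X such that every continuous pseudometric on X is uniformly continuous with respect to 𝒰 and 𝒰 has a 𝔊-base, and suppose the set C(X) of continuous real-valued functions is ω^ω-dominated in ℝ^X. Then X is cosmic and σ-compact. -/

import Mathlib

/-- A topological space is cosmic if it has a countable network. -/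
def Cosmic (Y : Type*) [TopologicalSpace Y] : Prop :=
  ∃ N : Set (Set Y), N.Countable ∧
    ∀ y : Y, ∀ U : Set Y, IsOpen U → y ∈ U → ∃ s ∈ N, y ∈ s ∧ s ⊆ U

namespace GB

open Set Filter Topology

def Ext : List ℕ → (ℕ → ℕ) → Prop
  | [], _ => True
  | (i :: l), α => α l.length = i ∧ Ext l α

def pre (α : ℕ → ℕ) : ℕ → List ℕ
  | 0 => []
  | n + 1 => α n :: pre α n

lemma pre_length (α : ℕ → ℕ) (n : ℕ) : (pre α n).length = n := by
  induction n with
  | zero => rfl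
  | succ n ih => simp [pre, ih]

lemma ext_pre (α β : ℕ → ℕ) (n : ℕ) : Ext (pre α n) β ↔ ∀ k < n, β k = α k := by
  induction n with
  | zero => simp [pre, Ext]
  | succ n ih =>
    simp only [pre, Ext, pre_length, ih]
    constructor
    · rintro ⟨h1, h2⟩ k hk
      rcases Nat.lt_succ_iff_lt_or_eq.1 hk with h | h
      · exact h2 k h
      · rw [h]; exact h1
    · intro h
      exact ⟨h n (Nat.lt_succ_self n), fun k hk => h k (Nat.lt_succ_of_lt hk)⟩

lemma ext_pre_self (α : ℕ → ℕ) (n : ℕ) : Ext (pre α n) α :=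
  (ext_pre α α n).2 fun _ _ => rfl

lemma exists_sup (α : ℕ → ℕ) (β : ℕ → ℕ → ℕ) (h : ∀ n, Ext (pre α n) (β n)) :
    ∃ γ : ℕ → ℕ, α ≤ γ ∧ ∀ n, β n ≤ γ := by
  refine ⟨fun k => α k + ∑ n ∈ Finset.range (k + 1), β n k, fun k => Nat.le_add_right _ _, ?_⟩
  intro n k
  by_cases hk : k < n
  · have := (ext_pre α (β n) n).1 (h n) k hk
    show β n k ≤ _
    rw [this]; exact Nat.le_add_right _ _
  · have : β n k ≤ ∑ n ∈ Finset.range (k + 1), β n k :=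
      Finset.single_le_sum (f := fun n => β n k) (fun _ _ => Nat.zero_le _)
        (Finset.mem_range.2 (by omega))
    exact this.trans (Nat.le_add_left _ _)

lemma bump {X : Type*} [TopologicalSpace X] [CompletelyRegularSpace X] (x : X) (O : Set X)
    (hO : IsOpen O) (hx : x ∈ O) :
    ∃ g : X → ℝ, Continuous g ∧ (∀ y, 0 ≤ g y) ∧ (∀ y, g y ≤ 1) ∧ g x = 1 ∧ ∀ y, y ∉ O → g y = 0 := by
  obtain ⟨f, hf, h0, h1⟩ := CompletelyRegularSpace.completely_regular x Oᶜ hO.isClosed_compl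
    (by simpa using hx)
  refine ⟨fun y => 1 - (f y : ℝ), by fun_prop, fun y => ?_, fun y => ?_, ?_, fun y hy => ?_⟩
  · have := (f y).2.2; simp only [sub_nonneg]; exact this
  · have := (f y).2.1; simp only [tsub_le_iff_right, le_add_iff_nonneg_right]; exact this
  · simp [h0]
  · have := h1 hy
    simp [this]

/-- Boundedness on a cylinder. -/
lemma exists_bdd {X : Type*} (φ : (ℕ → ℕ) → (X → ℝ)) (hφ : Monotone φ) (α : ℕ → ℕ) (x : X) :
    ∃ n, ∃ m : ℝ, ∀ β, Ext (pre α n) β → φ β x ≤ m := by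
  by_contra hcon
  push Not at hcon
  choose β hβ hb using fun n : ℕ => hcon n n
  obtain ⟨γ, -, hγ⟩ := exists_sup α β hβ
  obtain ⟨n, hn⟩ := exists_nat_gt (φ γ x)
  have := hφ (hγ n) x
  linarith [hb n]

/-- Uniformly discrete sets are countable. -/
lemma discrete_countable {X : Type*} [UniformSpace X] [CompletelyRegularSpace X]
    (φ : (ℕ → ℕ) → (X → ℝ)) (hφ : Monotone φ)
    (hd : ∀ f : X → ℝ, Continuous f → ∃ α : ℕ → ℕ, f ≤ φ α)
    (V : Set (X × X)) (hV : V ∈ uniformity X) (D : Set X)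
    (hD : ∀ x ∈ D, ∀ y ∈ D, x ≠ y → (x, y) ∉ V) : D.Countable := by
  classical
  by_contra hunc
  obtain ⟨W0, hW0, hW0s, hW0V⟩ := comp_symm_mem_uniformity_sets hV
  obtain ⟨W, hW, hWs, hWV⟩ := comp_symm_mem_uniformity_sets hW0
  have key : ∀ a b c x y : X, (x, a) ∈ W → (a, b) ∈ W → (b, c) ∈ W → (c, y) ∈ W → (x, y) ∈ V := by
    intro a b c x y h1 h2 h3 h4
    exact hW0V ⟨b, hWV ⟨a, h1, h2⟩, hWV ⟨c, h3, h4⟩⟩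
  have hsy : ∀ a b : X, (a, b) ∈ W → (b, a) ∈ W := fun a b h => hWs.symm _ _ h
  -- extension of functions
  have hext : ∀ f : D → ℝ, (∀ x, 0 ≤ f x) → ∃ F : X → ℝ, Continuous F ∧ ∀ x : D, f x ≤ F x := by
    intro f hf
    have hb : ∀ x : D, ∃ g : X → ℝ, Continuous g ∧ (∀ y, 0 ≤ g y) ∧ (∀ y, g y ≤ 1) ∧ g x = 1 ∧
        ∀ y, y ∉ interior {y | ((x : X), y) ∈ W} → g y = 0 := fun x =>
      bump (x : X) _ isOpen_interior (mem_interior_iff_mem_nhds.2 (UniformSpace.mem_nhds_iff.2 ⟨W, hW, fun y hy => hy⟩))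
    choose g hgc hg0 hg1 hgx hgs using hb
    have hsupp : ∀ (x : D) (y : X), g x y ≠ 0 → ((x : X), y) ∈ W := by
      intro x y h
      by_contra h'
      exact h (hgs x y fun h'' => h' (interior_subset (s := {y | ((x : X), y) ∈ W}) h''))
    have huniq : ∀ (x x' : D) (y y' : X), g x y ≠ 0 → g x' y' ≠ 0 → ∀ c, (c, y) ∈ W → (c, y') ∈ W → x = x' := by
      intro x x' y y' h h' c hc hc'
      by_contra hne
      exact hD x x.2 x' x'.2 (fun h => hne (Subtype.ext h))
        (key y c y' x x' (hsupp _ _ h) (hsy _ _ hc) hc' (hsy _ _ (hsupp _ _ h')))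
    have hlf : LocallyFinite fun x : D => Function.support fun y => f x * g x y := by
      intro c
      refine ⟨{y | (c, y) ∈ W}, UniformSpace.mem_nhds_iff.2 ⟨W, hW, fun y hy => hy⟩, ?_⟩
      apply Set.Subsingleton.finite
      rintro x ⟨y, hy, hcy⟩ x' ⟨y', hy', hcy'⟩
      refine huniq x x' y y' ?_ ?_ c hcy hcy'
      · intro h; exact hy (by simp [h])
      · intro h; exact hy' (by simp [h])
    refine ⟨fun y => ∑ᶠ x : D, f x * g x y, continuous_finsum (fun x => continuous_const.mul (hgc x)) hlf, ?_⟩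
    intro x
    have := single_le_finsum (f := fun x' : D => f x' * g x' x) x
      (hlf.point_finite (x : X)) (fun x' => mul_nonneg (hf _) (hg0 _ _))
    simpa [hgx] using this
  -- the sets A
  let A : List ℕ → Set D := fun l => {x | ∃ m : ℝ, ∀ β, Ext l β → φ β x ≤ m}
  have hA : ∀ α, ∃ n, (A (pre α n)).Infinite := by
    intro α
    by_contra hcon
    push Not at hcon
    apply hunc
    have : (⋃ n, A (pre α n)) = univ := by
      ext x
      simp only [mem_iUnion, mem_univ, iff_true]
      exact exists_bdd φ hφ α x
    have h2 : (univ : Set D).Countable := by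
      rw [← this]
      exact countable_iUnion fun n => (hcon n).countable
    exact Set.countable_coe_iff.1 (Set.countable_univ_iff.1 h2)
  have hm : ∀ (l : List ℕ) (x : D), ∃ m : ℝ, 0 ≤ m ∧ (x ∈ A l → ∀ β, Ext l β → φ β x ≤ m) := by
    intro l x
    by_cases h : x ∈ A l
    · obtain ⟨m, hm⟩ := h
      exact ⟨max m 0, le_max_right _ _, fun _ β hβ => (hm β hβ).trans (le_max_left _ _)⟩
    · exact ⟨0, le_rfl, fun h' => absurd h' h⟩
  choose m hm0 hm using hm
  have hT : ∀ l : List ℕ, ∃ T : Set D, T.Countable ∧ T ⊆ A l ∧ ((A l).Infinite → T.Infinite) := by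
    intro l
    by_cases h : (A l).Infinite
    · refine ⟨range fun n => ((h.natEmbedding _ n : A l) : D), countable_range _, ?_, fun _ => ?_⟩
      · rintro _ ⟨n, rfl⟩; exact (h.natEmbedding _ n).2
      · exact infinite_range_of_injective
          (Subtype.val_injective.comp (h.natEmbedding _).injective)
    · exact ⟨∅, countable_empty, empty_subset _, fun h' => absurd h' h⟩
  choose T hTc hTA hTi using hT
  have hTT : (⋃ l, T l).Countable := countable_iUnion hTc
  obtain ⟨e, he⟩ := countable_iff_exists_injOn.1 hTT
  obtain ⟨F, hFc, hF⟩ := hext (fun x => 1 + ∑ k ∈ Finset.range (e x + 1), 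
      (match (Encodable.decode k : Option (List ℕ)) with | some l => m l x | none => 0)) (by
    intro x
    refine add_nonneg zero_le_one (Finset.sum_nonneg fun k _ => ?_)
    split
    · exact hm0 _ _
    · exact le_rfl)
  obtain ⟨α, hα⟩ := hd F hFc
  obtain ⟨n, hn⟩ := hA α
  set l := pre α n with hl
  have : ∃ t ∈ T l, Encodable.encode l ≤ e t := by
    by_contra hcon
    push Not at hcon
    refine hTi l hn ?_
    refine Set.Finite.of_finite_image (f := e) ((finite_Iio (Encodable.encode l)).subset ?_) ?_
    · rintro _ ⟨t, ht, rfl⟩; exact hcon t ht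
    · exact he.mono (subset_iUnion T l)
  obtain ⟨x, hxT, hxe⟩ := this
  have h1 := hm l x (hTA l hxT) α (ext_pre_self α n)
  have h2 := (hF x).trans (hα x)
  have h3 : m l x ≤ ∑ k ∈ Finset.range (e x + 1), 
      (match (Encodable.decode k : Option (List ℕ)) with | some l => m l x | none => 0) := by
    have := Finset.single_le_sum (f := fun k => (match (Encodable.decode k : Option (List ℕ)) with | some l => m l x | none => 0))
      (s := Finset.range (e x + 1)) (fun k _ => by
        split
        · exact hm0 _ _
        · exact le_rfl) (Finset.mem_range.2 (Nat.lt_succ_of_le hxe))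
    simpa using this
  linarith

lemma exists_dense {X : Type*} [UniformSpace X] [CompletelyRegularSpace X]
    (hb : ∀ B : Set (ℕ → ℕ), Cardinal.mk ↥B ≤ Cardinal.aleph 1 →
      ∃ C : Set (ℕ → ℕ), C.Countable ∧ ∀ f ∈ B, ∃ g ∈ C, f ≤ g)
    (U : (ℕ → ℕ) → Set (X × X)) (hU : ∀ α, U α ∈ uniformity X)
    (hUb : ∀ V ∈ uniformity X, ∃ α, U α ⊆ V) (hUm : ∀ α β : ℕ → ℕ, α ≤ β → U β ⊆ U α)
    (φ : (ℕ → ℕ) → (X → ℝ)) (hφ : Monotone φ)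
    (hd : ∀ f : X → ℝ, Continuous f → ∃ α : ℕ → ℕ, f ≤ φ α) :
    ∃ S : Set X, S.Countable ∧ Dense S := by
  by_contra hcon
  have hcon' : ∀ S : Set X, S.Countable → ∃ x, x ∉ closure S := by
    intro S hS
    by_contra h
    push Not at h
    exact hcon ⟨S, hS, h⟩
  let Ω : Type := (Cardinal.aleph 1).ord.ToType
  have hΩ : ∀ i : Ω, (Iio i).Countable := by
    intro i
    have := Cardinal.mk_Iio_toType_ord_lt i
    exact Cardinal.le_aleph0_iff_set_countable.1 (Cardinal.lt_aleph_one_iff.1 this)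
  have hΩu : ¬ (univ : Set Ω).Countable := by
    intro h
    have h1 := Cardinal.le_aleph0_iff_set_countable.2 h
    rw [Cardinal.mk_univ, Cardinal.mk_ord_toType] at h1
    exact absurd h1 (not_le.2 (Cardinal.aleph0_lt_aleph_one))
  have : Nonempty X := ⟨(hcon' ∅ countable_empty).choose⟩
  choose! pick hpick using hcon'
  let x : Ω → X := (wellFounded_lt (α := Ω)).fix fun i prev =>
    pick (range fun j : Iio i => prev j.1 j.2)
  have hx : ∀ i : Ω, x i ∉ closure (x '' Iio i) := by
    intro i
    have h1 : x i = pick (range fun j : Iio i => x j.1) :=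
      (wellFounded_lt (α := Ω)).fix_eq _ i
    have h2 : (range fun j : Iio i => x j.1) = x '' Iio i := by
      rw [image_eq_range]
    rw [h1, h2]
    exact hpick _ ((hΩ i).image _)
  have hα : ∀ i : Ω, ∃ α, ∀ j < i, (x i, x j) ∉ U α := by
    intro i
    have h1 : (closure (x '' Iio i))ᶜ ∈ 𝓝 (x i) := isClosed_closure.isOpen_compl.mem_nhds (hx i)
    obtain ⟨V, hV, hVs⟩ := UniformSpace.mem_nhds_iff.1 h1
    obtain ⟨α, hα⟩ := hUb V hV
    refine ⟨α, fun j hj hmem => ?_⟩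
    exact hVs (hα hmem) (subset_closure ⟨j, hj, rfl⟩)
  choose a ha using hα
  obtain ⟨C, hC, hCd⟩ := hb (range a) (by
    have := Cardinal.mk_range_le (f := a)
    rwa [Cardinal.mk_ord_toType] at this)
  have hc : ∃ c ∈ C, ¬ {i : Ω | a i ≤ c}.Countable := by
    by_contra h
    push Not at h
    apply hΩu
    refine (hC.biUnion h).mono ?_
    intro i _
    obtain ⟨g, hg, hag⟩ := hCd (a i) ⟨i, rfl⟩
    exact mem_iUnion₂.2 ⟨g, hg, hag⟩
  obtain ⟨c, -, hc⟩ := hc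
  have hxx : ∀ i j, j < i → a i ≤ c → (x i, x j) ∉ U c := fun i j hij hi h =>
    ha i j hij (hUm _ _ hi h)
  have hinj : Function.Injective x := by
    intro i j hij
    by_contra hne
    rcases lt_or_gt_of_ne hne with h | h
    · exact hx j (subset_closure ⟨i, h, hij⟩)
    · exact hx i (subset_closure ⟨j, h, hij.symm⟩)
  obtain ⟨V, hV, hVs, hVU⟩ := comp_symm_mem_uniformity_sets (hU c)
  have hVU' : V ⊆ U c := fun p hp => hVU ⟨p.2, hp, refl_mem_uniformity hV⟩
  have := discrete_countable φ hφ hd V hV (x '' {i : Ω | a i ≤ c}) (by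
    rintro _ ⟨i, hi, rfl⟩ _ ⟨j, hj, rfl⟩ hne hmem
    have hij : i ≠ j := fun h => hne (by rw [h])
    rcases lt_or_gt_of_ne hij with h | h
    · exact hxx j i h hj (hVU' (hVs.symm _ _ hmem))
    · exact hxx i j h hi (hVU' hmem))
  exact hc (countable_of_injective_of_countable_image hinj.injOn this)

/-- `X` is cosmic. -/
lemma cosmic_aux {X : Type*} [UniformSpace X] [CompletelyRegularSpace X]
    (hfine : ∀ f : X → ℝ, Continuous f → ∀ ε : ℝ, 0 < ε →
      {p : X × X | |f p.1 - f p.2| < ε} ∈ uniformity X)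
    (U : (ℕ → ℕ) → Set (X × X)) (hU : ∀ α, U α ∈ uniformity X)
    (hUb : ∀ V ∈ uniformity X, ∃ α, U α ⊆ V) (hUm : ∀ α β : ℕ → ℕ, α ≤ β → U β ⊆ U α)
    (φ : (ℕ → ℕ) → (X → ℝ)) (hφ : Monotone φ)
    (hd : ∀ f : X → ℝ, Continuous f → ∃ α : ℕ → ℕ, f ≤ φ α)
    (S : Set X) (hS : S.Countable) (hSd : Dense S) : Cosmic X := by
  have : Countable S := hS
  let sl : (ℕ → ℕ) → ℕ → (ℕ → ℕ) := fun α n k => α (Nat.pair n k)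
  have hsl : ∀ α β, α ≤ β → ∀ n, sl α n ≤ sl β n := fun α β h n k => h _
  let K : (ℕ → ℕ) → Set (X → ℝ) := fun α =>
    {f | (∀ x, |f x| ≤ φ (sl α 0) x) ∧ ∀ n : ℕ, ∀ x y, (x, y) ∈ U (sl α (n + 1)) →
      |f x - f y| ≤ 1 / ((n : ℝ) + 1)}
  have hKm : ∀ α β, α ≤ β → K α ⊆ K β := by
    intro α β h f hf
    exact ⟨fun x => (hf.1 x).trans (hφ (hsl α β h 0) x),
      fun n x y hxy => hf.2 n x y (hUm _ _ (hsl α β h _) hxy)⟩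
  have hKcont : ∀ α, ∀ f ∈ K α, Continuous f := by
    intro α f hf
    rw [continuous_iff_continuousAt]
    intro x
    rw [ContinuousAt, Metric.tendsto_nhds]
    intro ε hε
    obtain ⟨n, hn⟩ := exists_nat_one_div_lt hε
    have : {y | (x, y) ∈ U (sl α (n + 1))} ∈ 𝓝 x :=
      UniformSpace.mem_nhds_iff.2 ⟨_, hU _, fun y hy => hy⟩
    filter_upwards [this] with y hy
    rw [Real.dist_eq, abs_sub_comm]
    exact (hf.2 n x y hy).trans_lt hn
  have hKcomp : ∀ α, IsCompact (K α) := by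
    intro α
    have h1 : IsCompact (Set.pi univ fun x => Icc (-(φ (sl α 0) x)) (φ (sl α 0) x)) :=
      isCompact_univ_pi fun x => isCompact_Icc
    refine h1.of_isClosed_subset ?_ ?_
    · have : K α = (⋂ x, {f | |f x| ≤ φ (sl α 0) x}) ∩
          ⋂ n : ℕ, ⋂ x, ⋂ y, ⋂ _ : (x, y) ∈ U (sl α (n + 1)),
            {f | |f x - f y| ≤ 1 / ((n : ℝ) + 1)} := by
        ext f
        simp [K]
      rw [this]
      refine IsClosed.inter (isClosed_iInter fun x => isClosed_le (by fun_prop) (by fun_prop)) ?_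
      refine isClosed_iInter fun n => isClosed_iInter fun x => isClosed_iInter fun y =>
        isClosed_iInter fun _ => isClosed_le (by fun_prop) (by fun_prop)
    · intro f hf x _
      exact abs_le.1 (hf.1 x)
  have hKall : ∀ f : X → ℝ, Continuous f → ∃ α, f ∈ K α := by
    intro f hf
    obtain ⟨a0, ha0⟩ := hd (fun x => |f x|) hf.abs
    have h1 : ∀ n : ℕ, ∃ a, ∀ x y, (x, y) ∈ U a → |f x - f y| ≤ 1 / ((n : ℝ) + 1) := by
      intro n
      obtain ⟨a, ha⟩ := hUb _ (hfine f hf (1 / ((n : ℝ) + 1)) (by positivity))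
      exact ⟨a, fun x y hxy => le_of_lt (ha hxy)⟩
    choose a ha using h1
    let b : ℕ → ℕ → ℕ := fun n => Nat.casesOn n a0 a
    let α : ℕ → ℕ := fun m => b (Nat.unpair m).1 (Nat.unpair m).2
    have hα : ∀ n, sl α n = b n := by
      intro n; funext k; simp [sl, α]
    refine ⟨α, ?_, ?_⟩
    · intro x; rw [hα 0]; exact ha0 x
    · intro n x y hxy
      rw [hα] at hxy
      exact ha n x y hxy
  let π : (X → ℝ) → (S → ℝ) := fun f s => f s
  have hπ : Continuous π := by fun_prop
  let P : List ℕ → Set (S → ℝ) → Set (X → ℝ) := fun l B =>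
    {g | (∃ β, Ext l β ∧ g ∈ K β) ∧ π g ∈ B}
  let N : List ℕ × Set (S → ℝ) → Set X := fun q => {x | ∀ g ∈ P q.1 q.2, 1 / 2 < g x}
  refine ⟨N '' (univ ×ˢ TopologicalSpace.countableBasis (S → ℝ)),
    (countable_univ.prod (TopologicalSpace.countable_countableBasis _)).image _, ?_⟩
  intro x O hO hxO
  obtain ⟨f, hfc, -, -, hfx, hf0⟩ := bump x O hO hxO
  obtain ⟨α, hα⟩ := hKall f hfc
  have hmain : ∃ n, ∃ B ∈ TopologicalSpace.countableBasis (S → ℝ), π f ∈ B ∧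
      ∀ g ∈ P (pre α n) B, 1 / 2 < g x := by
    by_contra hcon
    push Not at hcon
    obtain ⟨V, hV⟩ := (𝓝 (π f)).exists_antitone_basis
    have h1 : ∀ n, ∃ B ∈ TopologicalSpace.countableBasis (S → ℝ), π f ∈ B ∧ B ⊆ V n := fun n =>
      (TopologicalSpace.isBasis_countableBasis (S → ℝ)).mem_nhds_iff.1 (hV.mem n)
    choose B hB hfB hBV using h1
    choose g hg hgx using fun n => hcon n (B n) (hB n) (hfB n)
    choose β hβ hgβ using fun n => (hg n).1
    obtain ⟨γ, hαγ, hγ⟩ := exists_sup α β hβ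
    have hgγ : ∀ n, g n ∈ K γ := fun n => hKm _ _ (hγ n) (hgβ n)
    obtain ⟨g', hg', hcl⟩ := (hKcomp γ).exists_mapClusterPt (f := atTop) (u := g)
      (le_principal_iff.2 (mem_map.2 (Eventually.of_forall hgγ)))
    have hlim : Tendsto (fun n => π (g n)) atTop (𝓝 (π f)) :=
      hV.tendsto fun n => hBV n (hg n).2
    have hcl2 : MapClusterPt (π g') atTop (fun n => π (g n)) := hcl.continuousAt_comp hπ.continuousAt
    have heq : π g' = π f := by
      by_contra hne
      have hdis := disjoint_nhds_nhds.2 hne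
      have : ClusterPt (π g') (map (fun n => π (g n)) atTop) := hcl2
      exact (this.mono hlim).ne (disjoint_iff.1 hdis)
    have hgf : g' = f := Continuous.ext_on hSd (hKcont γ g' hg') hfc
      (fun s hs => congrFun heq ⟨s, hs⟩)
    have hcl3 : g' ∈ {h : X → ℝ | h x ≤ 1 / 2} := by
      have hclosed : IsClosed {h : X → ℝ | h x ≤ 1 / 2} :=
        isClosed_le (by fun_prop) (by fun_prop)
      exact hclosed.mem_of_mapClusterPt hcl (Eventually.of_forall hgx)
    rw [hgf] at hcl3
    have : f x ≤ 1 / 2 := hcl3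
    rw [hfx] at this
    norm_num at this
  obtain ⟨n, B, hB, hfB, hall⟩ := hmain
  refine ⟨_, ⟨(pre α n, B), ⟨mem_univ _, hB⟩, rfl⟩, hall, ?_⟩
  intro y hy
  by_contra hyO
  have := hy f ⟨⟨α, ext_pre_self α n, hα⟩, hfB⟩
  rw [hf0 y hyO] at this
  norm_num at this

lemma network_lindelof {X : Type*} [TopologicalSpace X] (hX : Cosmic X) (A : Set X)
    (O : X → Set X) (hO : ∀ x, IsOpen (O x)) (hx : ∀ x ∈ A, x ∈ O x) :
    ∃ S : Set X, S.Countable ∧ S ⊆ A ∧ A ⊆ ⋃ x ∈ S, O x := by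
  classical
  obtain ⟨N, hN, hnet⟩ := hX
  by_cases hne : Nonempty X
  swap
  · exact ⟨∅, countable_empty, empty_subset _, fun x _ => (hne ⟨x⟩).elim⟩
  let c : Set X → X := fun s => if h : ∃ x ∈ A, s ⊆ O x then h.choose else Classical.choice hne
  refine ⟨c '' {s ∈ N | ∃ x ∈ A, s ⊆ O x}, (hN.mono (sep_subset _ _)).image _, ?_, ?_⟩
  · rintro _ ⟨s, ⟨-, h⟩, rfl⟩
    simp only [c, dif_pos h]
    exact h.choose_spec.1
  · intro x hxA
    obtain ⟨s, hs, hxs, hsO⟩ := hnet x (O x) (hO x) (hx x hxA)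
    have h : ∃ x ∈ A, s ⊆ O x := ⟨x, hxA, hsO⟩
    refine mem_iUnion₂.2 ⟨c s, ⟨s, ⟨hs, h⟩, rfl⟩, ?_⟩
    simp only [c, dif_pos h]
    exact h.choose_spec.2 hxs

lemma bounded_compact {X : Type*} [TopologicalSpace X] [CompletelyRegularSpace X] (hX : Cosmic X)
    (B : Set X) (hB : ∀ h : X → ℝ, Continuous h → ∃ M : ℝ, ∀ x ∈ B, h x ≤ M) :
    IsCompact (closure B) := by
  rw [isCompact_iff_ultrafilter_le_nhds]
  intro F hF
  by_contra hcon
  push Not at hcon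
  have hlim : ∀ x, ¬ (F : Filter X) ≤ 𝓝 x := by
    intro x hx
    have : x ∈ closure B := by
      have h1 : closure B ∈ (F : Filter X) := by simpa using hF
      exact isClosed_closure.mem_of_tendsto (f := id) (b := (F : Filter X)) hx h1
    exact hcon x this hx
  have hg : ∀ x, ∃ g : X → ℝ, Continuous g ∧ (∀ y, 0 ≤ g y) ∧ (∀ y, g y ≤ 1) ∧ g x = 1 ∧
      {y | g y = 0} ∈ (F : Filter X) := by
    intro x
    have : ∃ s ∈ 𝓝 x, s ∉ (F : Filter X) := by
      by_contra h
      push Not at h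
      exact hlim x h
    obtain ⟨s, hs, hsF⟩ := this
    obtain ⟨g, h1, h2, h3, h4, h5⟩ := bump x (interior s) isOpen_interior
      (mem_interior_iff_mem_nhds.2 hs)
    refine ⟨g, h1, h2, h3, h4, ?_⟩
    have : sᶜ ∈ (F : Filter X) := Ultrafilter.compl_mem_iff_notMem.2 hsF
    filter_upwards [this] with y hy
    exact h5 y fun h => hy (interior_subset h)
  choose g hgc hg0 hg1 hgx hgF using hg
  obtain ⟨S, hS, -, hcov⟩ := network_lindelof hX univ (fun x => {y | 0 < g x y})
    (fun x => isOpen_lt continuous_const (hgc x)) (fun x _ => by simp [hgx])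
  have hSne : S.Nonempty := by
    obtain ⟨x, -⟩ := F.nonempty_of_mem (s := univ) univ_mem
    obtain ⟨s, hs, -⟩ := mem_iUnion₂.1 (hcov (mem_univ x))
    exact ⟨s, hs⟩
  obtain ⟨e, he⟩ := hS.exists_eq_range hSne
  have hsum : ∀ y, Summable fun k : ℕ => (1 / 2 : ℝ) ^ k * g (e k) y := fun y =>
    Summable.of_nonneg_of_le (fun k => mul_nonneg (by positivity) (hg0 _ _))
      (fun k => mul_le_of_le_one_right (by positivity) (hg1 _ _)) summable_geometric_two
  let G : X → ℝ := fun y => ∑' k : ℕ, (1 / 2 : ℝ) ^ k * g (e k) y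
  have hGc : Continuous G := by
    refine continuous_tsum (fun k => continuous_const.mul (hgc (e k))) summable_geometric_two ?_
    intro k y
    rw [Real.norm_of_nonneg (mul_nonneg (by positivity) (hg0 _ _))]
    exact mul_le_of_le_one_right (by positivity) (hg1 _ _)
  have hGpos : ∀ y, 0 < G y := by
    intro y
    obtain ⟨s, hs, hsy⟩ := mem_iUnion₂.1 (hcov (mem_univ y))
    rw [he] at hs
    obtain ⟨k, rfl⟩ := hs
    exact (hsum y).tsum_pos (fun k => mul_nonneg (by positivity) (hg0 _ _)) k
      (mul_pos (by positivity) hsy)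
  obtain ⟨M, hM⟩ := hB (fun y => (G y)⁻¹) (hGc.inv₀ fun y => (hGpos y).ne')
  have hM' : ∀ x ∈ closure B, (G x)⁻¹ ≤ M := by
    intro x hx
    have hcl : IsClosed {x | (G x)⁻¹ ≤ M} :=
      isClosed_le (hGc.inv₀ fun y => (hGpos y).ne') continuous_const
    exact closure_minimal hM hcl hx
  obtain ⟨n, hn⟩ := exists_nat_gt M
  have hsmall : {y | ∀ k ∈ Finset.range n, g (e k) y = 0} ∈ (F : Filter X) := by
    have := (Filter.biInter_finset_mem (f := (F : Filter X)) (s := fun k => {y | g (e k) y = 0})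
      (Finset.range n)).2 (fun k _ => hgF (e k))
    filter_upwards [this] with y hy k hk
    exact mem_iInter₂.1 hy k hk
  obtain ⟨y, hy1, hy2⟩ := F.nonempty_of_mem (inter_mem hsmall (by simpa using hF : closure B ∈ (F : Filter X)))
  have h1 : G y ≤ (1 / 2 : ℝ) ^ n * 2 := by
    have hz : ∑ k ∈ Finset.range n, (1 / 2 : ℝ) ^ k * g (e k) y = 0 :=
      Finset.sum_eq_zero fun k hk => by rw [hy1 k hk, mul_zero]
    have h2 := (hsum y).sum_add_tsum_nat_add n
    rw [hz, zero_add] at h2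
    change _ = G y at h2
    rw [← h2]
    have h3 : Summable fun k : ℕ => (1 / 2 : ℝ) ^ n * (1 / 2 : ℝ) ^ k :=
      summable_geometric_two.mul_left _
    refine (Summable.tsum_le_tsum (fun k => ?_) ((summable_nat_add_iff n).2 (hsum y)) h3).trans ?_
    · rw [pow_add, mul_comm ((1 / 2 : ℝ) ^ k)]
      exact mul_le_of_le_one_right (by positivity) (hg1 _ _)
    · rw [tsum_mul_left, tsum_geometric_two]
  have h2 := hM' y hy2
  have h3 : (2 : ℝ) ^ n / 2 ≤ (G y)⁻¹ := by
    rw [le_inv_comm₀ (by positivity) (hGpos y)]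
    refine h1.trans (le_of_eq ?_)
    rw [one_div, inv_pow]; field_simp
  have h4 : (n : ℝ) ≤ 2 ^ n / 2 := by
    rcases n with _ | n
    · norm_num
    · have : n + 1 ≤ 2 ^ n := Nat.lt_two_pow_self
      have h5 : ((n : ℝ) + 1) ≤ 2 ^ n := by exact_mod_cast this
      rw [pow_succ]; push_cast; linarith
  linarith

def Good {X : Type*} [TopologicalSpace X] (φ : (ℕ → ℕ) → (X → ℝ)) (l : List ℕ) (W : Set X) : Prop :=
  ∀ f : X → ℝ, Continuous f → (∀ x, 0 ≤ f x) → (∀ x, x ∉ W → f x = 0) → ∃ α, Ext l α ∧ f ≤ φ α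

lemma Good.step {X : Type*} [TopologicalSpace X] (φ : (ℕ → ℕ) → (X → ℝ)) (l : List ℕ) (W : Set X)
    (hW : Good φ l W) (h : X → ℝ) (hh : Continuous h) :
    ∃ i : ℕ, Good φ (i :: l) (W ∩ {x | (i : ℝ) < h x}) := by
  by_contra hcon
  simp only [Good] at hcon
  push Not at hcon
  choose f hfc hf0 hfs hfn using hcon
  have hlf : LocallyFinite fun i => Function.support (f i) := by
    intro x
    obtain ⟨n, hn⟩ := exists_nat_gt (h x)
    refine ⟨{y | h y < n}, (isOpen_lt hh continuous_const).mem_nhds hn, ?_⟩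
    refine (finite_Iio n).subset ?_
    rintro i ⟨y, hy, hyn⟩
    by_contra hi
    refine hy (hfs i y ?_)
    rintro ⟨-, h2⟩
    have : (n : ℝ) ≤ i := by exact_mod_cast not_lt.1 hi
    have h3 : (i : ℝ) < h y := h2
    have h4 : h y < n := hyn
    linarith
  obtain ⟨α, hα, hle⟩ := hW (fun x => ∑ᶠ i, f i x) (continuous_finsum hfc hlf)
    (fun x => finsum_nonneg fun i => hf0 i x)
    (fun x hx => by
      rw [← finsum_zero (α := ℕ)]
      exact finsum_congr fun i => hfs i x fun h => hx h.1)
  refine hfn (α l.length) α ⟨rfl, hα⟩ fun x => ?_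
  exact (single_le_finsum (f := fun i => f i x) _ (hlf.point_finite x) fun i => hf0 i x).trans (hle x)

lemma Good.mono {X : Type*} [TopologicalSpace X] {φ : (ℕ → ℕ) → (X → ℝ)} {l : List ℕ} {W W' : Set X}
    (hW : Good φ l W) (h : W' ⊆ W) : Good φ l W' := fun f h1 h2 h3 =>
  hW f h1 h2 fun x hx => h3 x fun hx' => hx (h hx')

lemma Good.contra {X : Type*} [TopologicalSpace X] [CompletelyRegularSpace X]
    {φ : (ℕ → ℕ) → (X → ℝ)} (hφ : Monotone φ)
    (α : ℕ → ℕ) (W : ℕ → Set X) (hWo : ∀ n, IsOpen (W n)) (hW : ∀ n, Good φ (pre α n) (W n))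
    (x : X) (hx : ∀ n, x ∈ W n) : False := by
  have : ∀ n : ℕ, ∃ β, Ext (pre α n) β ∧ (n : ℝ) ≤ φ β x := by
    intro n
    obtain ⟨g, h1, h2, h3, h4, h5⟩ := bump x (W n) (hWo n) (hx n)
    obtain ⟨β, hβ, hle⟩ := hW n (fun y => n * g y) (continuous_const.mul h1)
      (fun y => mul_nonneg (Nat.cast_nonneg n) (h2 y)) (fun y hy => by rw [h5 y hy, mul_zero])
    refine ⟨β, hβ, ?_⟩
    have := hle x
    simpa [h4] using this
  choose β hβ hn using this
  obtain ⟨γ, -, hγ⟩ := exists_sup α β hβ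
  obtain ⟨n, hn'⟩ := exists_nat_gt (φ γ x)
  have := hφ (hγ n) x
  linarith [hn n]

lemma measurable_range {X : Type*} [TopologicalSpace X] [CompletelyRegularSpace X]
    (φ : (ℕ → ℕ) → (X → ℝ)) (hφ : Monotone φ)
    (hd : ∀ f : X → ℝ, Continuous f → ∃ α : ℕ → ℕ, f ≤ φ α)
    {K : Type*} [MetricSpace K] [MeasurableSpace K] [BorelSpace K] (e : X → K) (he : Continuous e) :
    MeasurableSet (range e) := by
  classical
  let G : List ℕ → Set K := fun l => ⋃₀ {W | IsOpen W ∧ Good φ l (e ⁻¹' W)}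
  have hGo : ∀ l, IsOpen (G l) := fun l => isOpen_sUnion fun W hW => hW.1
  have hG0 : G [] = univ := by
    refine eq_univ_of_forall fun z => ⟨univ, ⟨isOpen_univ, ?_⟩, mem_univ z⟩
    intro f hf _ _
    obtain ⟨α, hα⟩ := hd f hf
    exact ⟨α, trivial, hα⟩
  have hGs : ∀ l y, y ∉ range e → y ∈ G l → ∃ i, y ∈ G (i :: l) := by
    rintro l y hy ⟨W, ⟨hWo, hW⟩, hyW⟩
    have hpos : ∀ x, 0 < dist (e x) y := fun x => dist_pos.2 fun h => hy ⟨x, h⟩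
    obtain ⟨i, hi⟩ := Good.step φ l _ hW (fun x => (dist (e x) y)⁻¹)
      ((he.dist continuous_const).inv₀ fun x => (hpos x).ne')
    refine ⟨i, W ∩ Metric.ball y (1 / ((i : ℝ) + 1)), ⟨hWo.inter Metric.isOpen_ball, ?_⟩, hyW,
      Metric.mem_ball_self (by positivity)⟩
    refine hi.mono ?_
    rintro x ⟨hx1, hx2⟩
    refine ⟨hx1, ?_⟩
    have h1 : dist (e x) y < 1 / ((i : ℝ) + 1) := hx2
    show (i : ℝ) < (dist (e x) y)⁻¹
    have h2 : ((i : ℝ) + 1) < (dist (e x) y)⁻¹ := by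
      rw [lt_inv_comm₀ (by positivity) (hpos x), ← one_div]; exact h1
    linarith
  let E : List ℕ → Set K := fun l => List.rec univ
    (fun i l (P : Set K) => P ∩ (G (i :: l) \ ⋃ j ∈ Iio i, G (j :: l))) l
  have hE0 : E [] = univ := rfl
  have hEs : ∀ i l, E (i :: l) = E l ∩ (G (i :: l) \ ⋃ j ∈ Iio i, G (j :: l)) := fun i l => rfl
  have hEm : ∀ l, MeasurableSet (E l) := by
    intro l
    induction l with
    | nil => rw [hE0]; exact MeasurableSet.univ
    | cons i l ih =>
      rw [hEs]
      exact ih.inter ((hGo _).measurableSet.diff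
        (isOpen_biUnion fun j _ => hGo _).measurableSet)
  have hEG : ∀ l, E l ⊆ G l := by
    intro l
    cases l with
    | nil => exact hG0.symm ▸ subset_univ _
    | cons i l => rw [hEs]; exact fun z hz => hz.2.1
  have huniq : ∀ i j l z, z ∈ E (i :: l) → z ∈ G (j :: l) → i ≤ j := by
    intro i j l z hz hj
    by_contra h
    rw [hEs] at hz
    exact hz.2.2 (mem_iUnion₂.2 ⟨j, not_le.1 h, hj⟩)
  have huniq2 : ∀ l l' : List ℕ, l.length = l'.length → ∀ z, z ∈ E l → z ∈ E l' → l = l' := by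
    intro l
    induction l with
    | nil => intro l' h z _ _; exact (List.length_eq_zero_iff.1 h.symm).symm
    | cons i l ih =>
      intro l' h z hz hz'
      cases l' with
      | nil => simp at h
      | cons j l' =>
        have : l = l' := ih l' (by simpa using h) z (by rw [hEs] at hz; exact hz.1)
          (by rw [hEs] at hz'; exact hz'.1)
        subst this
        rw [le_antisymm (huniq i j l z hz (hEG _ hz')) (huniq j i l z hz' (hEG _ hz))]
  have hstep : ∀ l y, y ∉ range e → y ∈ E l → ∃ i, y ∈ E (i :: l) := by
    intro l y hy hyE
    have h := hGs l y hy (hEG l hyE)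
    refine ⟨Nat.find h, ?_⟩
    rw [hEs]
    refine ⟨hyE, Nat.find_spec h, ?_⟩
    rintro hmem
    obtain ⟨j, hj, hjG⟩ := mem_iUnion₂.1 hmem
    exact Nat.find_min h hj hjG
  have hfin : (range e)ᶜ = ⋂ n : ℕ, ⋃ l ∈ {l : List ℕ | l.length = n}, E l := by
    ext y
    simp only [mem_compl_iff, mem_iInter, mem_iUnion]
    constructor
    · intro hy n
      induction n with
      | zero => exact ⟨[], rfl, by rw [hE0]; exact mem_univ y⟩
      | succ n ih =>
        obtain ⟨l, hl, hyl⟩ := ih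
        obtain ⟨i, hi⟩ := hstep l y hy hyl
        have hl' : l.length = n := hl
        exact ⟨i :: l, by simp [hl'], hi⟩
    · rintro h ⟨x, rfl⟩
      choose s hs hsE using h
      have hs' : ∀ n, (s n).length = n := hs
      have hnext : ∀ n, ∃ i, s (n + 1) = i :: s n := by
        intro n
        have h1 := hs' (n + 1)
        have h2 := hsE (n + 1)
        cases hc : s (n + 1) with
        | nil => rw [hc] at h1; cases h1
        | cons i l =>
          rw [hc] at h1 h2
          refine ⟨i, ?_⟩
          rw [hEs] at h2
          rw [huniq2 l (s n) (by rw [hs' n]; simpa using h1) _ h2.1 (hsE n)]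
      choose a ha using hnext
      have hpre : ∀ n, s n = pre a n := by
        intro n
        induction n with
        | zero => exact List.length_eq_zero_iff.1 (hs' 0)
        | succ n ih => rw [ha, ih]; rfl
      have hW : ∀ n, ∃ W, (IsOpen W ∧ Good φ (pre a n) (e ⁻¹' W)) ∧ e x ∈ W := by
        intro n
        have := hEG _ (hsE n)
        rw [hpre] at this
        exact this
      choose W hW hxW using hW
      exact Good.contra hφ a (fun n => e ⁻¹' W n) (fun n => (hW n).1.preimage he)
        (fun n => (hW n).2) x hxW
  rw [← MeasurableSet.compl_iff, hfin]
  exact MeasurableSet.iInter fun n => MeasurableSet.biUnion (to_countable _) fun l _ => hEm l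

lemma exists_polish {X : Type*} [TopologicalSpace X] [CompletelyRegularSpace X] [T2Space X]
    (hX : Cosmic X) (φ : (ℕ → ℕ) → (X → ℝ)) (hφ : Monotone φ)
    (hd : ∀ f : X → ℝ, Continuous f → ∃ α : ℕ → ℕ, f ≤ φ α) [hne : Nonempty X] :
    ∃ (Z : Type) (_ : TopologicalSpace Z) (_ : PolishSpace Z) (p : Z → X),
      Continuous p ∧ Function.Surjective p := by
  classical
  have hX' := hX
  obtain ⟨N, hN, hnet⟩ := hX'
  have hNne : N.Nonempty := by
    obtain ⟨s, hs, -⟩ := hnet hne.some univ isOpen_univ (mem_univ _)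
    exact ⟨s, hs⟩
  obtain ⟨ν, rfl⟩ := hN.exists_eq_range hNne
  -- separating functions
  have hg : ∀ j : ℕ, ∃ g : ℕ → X → ℝ, (∀ k, Continuous (g k)) ∧
      ∀ x, x ∈ closure (ν j) ↔ ∀ k, g k x = 0 := by
    intro j
    have hb : ∀ x : X, ∃ g : X → ℝ, Continuous g ∧ (∀ y ∈ closure (ν j), g y = 0) ∧
        (x ∉ closure (ν j) → g x = 1) := by
      intro x
      by_cases hx : x ∈ closure (ν j)
      · exact ⟨fun _ => 0, continuous_const, fun _ _ => rfl, fun h => absurd hx h⟩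
      · obtain ⟨g, h1, -, -, h4, h5⟩ := bump x (closure (ν j))ᶜ isClosed_closure.isOpen_compl hx
        exact ⟨g, h1, fun y hy => h5 y fun h => h hy, fun _ => h4⟩
    choose g hgc hg0 hg1 using hb
    obtain ⟨S, hS, -, hcov⟩ := network_lindelof hX (closure (ν j))ᶜ (fun x => {y | g x y ≠ 0})
      (fun x => isOpen_ne_fun (hgc x) continuous_const)
      (fun x hx => by
        have := hg1 x hx
        simp [this])
    by_cases hSne : S.Nonempty
    · obtain ⟨e, he⟩ := hS.exists_eq_range hSne
      refine ⟨fun k => g (e k), fun k => hgc _, fun x => ⟨fun hx k => hg0 _ x hx, fun h => ?_⟩⟩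
      by_contra hx
      obtain ⟨s, hs, hsx⟩ := mem_iUnion₂.1 (hcov hx)
      rw [he] at hs
      obtain ⟨k, rfl⟩ := hs
      exact hsx (h k)
    · refine ⟨fun k _ => 0, fun k => continuous_const, fun x => ⟨fun _ _ => rfl, fun _ => ?_⟩⟩
      by_contra hx
      obtain ⟨s, hs, hsx⟩ := mem_iUnion₂.1 (hcov hx)
      exact hSne ⟨s, hs⟩
  choose g hgc hgz using hg
  let K : Type := ℕ × ℕ → ℝ
  let e : X → K := fun x q => g q.1 q.2 x
  have he : Continuous e := continuous_pi fun q => hgc q.1 q.2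
  have hnet2 : ∀ (x : X) (O : Set X), IsOpen O → x ∈ O → ∃ j, x ∈ closure (ν j) ∧ closure (ν j) ⊆ O := by
    intro x O hO hx
    obtain ⟨V, hV, hVc, hVO⟩ := exists_mem_nhds_isClosed_subset (hO.mem_nhds hx)
    obtain ⟨_, ⟨j, rfl⟩, hxj, hj⟩ := hnet x (interior V) isOpen_interior
      (mem_interior_iff_mem_nhds.2 hV)
    exact ⟨j, subset_closure hxj, (closure_minimal (hj.trans interior_subset) hVc).trans hVO⟩
  let C : ℕ → Set K := fun j => {z | ∀ k, z (j, k) = 0}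
  have hC : ∀ j x, e x ∈ C j ↔ x ∈ closure (ν j) := fun j x => (hgz j x).symm
  have hCc : ∀ j, IsClosed (C j) := by
    intro j
    have : C j = ⋂ k, {z : K | z (j, k) = 0} := by ext z; simp [C]
    rw [this]
    exact isClosed_iInter fun k => isClosed_eq (continuous_apply _) continuous_const
  have hinj : Function.Injective e := by
    intro x y hxy
    by_contra hne
    obtain ⟨j, hxj, hj⟩ := hnet2 x {y}ᶜ isOpen_compl_singleton hne
    have h1 := (hC j x).2 hxj
    rw [hxy] at h1
    exact hj ((hC j y).1 h1) rfl
  letI : MeasurableSpace K := borel K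
  haveI : BorelSpace K := ⟨rfl⟩
  have hmeas : MeasurableSet (range e) := by
    letI : MetricSpace K := TopologicalSpace.metrizableSpaceMetric K
    exact measurable_range φ hφ hd e he
  let T : Option ℕ → Set K := fun o => o.elim (range e) C
  have hT : ∀ o, PolishSpace.IsClopenable (T o) := by
    intro o
    apply MeasurableSet.isClopenable
    cases o with
    | none => exact hmeas
    | some j => exact (hCc j).measurableSet
  choose τ hτle hτP hτc hτo using hT
  obtain ⟨t', ht', -, htP⟩ := PolishSpace.exists_polishSpace_forall_le τ hτle hτP
  have hcl : IsClosed[t'] (range e) := (hτc none).mono (ht' none)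
  have hop : ∀ j, IsOpen[t'] (C j) := fun j => (hτo (some j)).mono (ht' (some j))
  letI tZ : TopologicalSpace (range e) := @instTopologicalSpaceSubtype K _ t'
  have hval : @Continuous (range e) K tZ t' Subtype.val := @continuous_subtype_val K t' _
  refine ⟨range e, tZ, @IsClosed.polishSpace K t' htP _ hcl, fun z => z.2.choose, ?_, ?_⟩
  · rw [continuous_def]
    intro O hO
    rw [isOpen_iff_forall_mem_open]
    intro z hz
    obtain ⟨j, hxj, hj⟩ := hnet2 _ O hO hz
    refine ⟨Subtype.val ⁻¹' (C j), ?_, (hop j).preimage hval, ?_⟩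
    · intro w hw
      apply hj
      rw [← hC, w.2.choose_spec]
      exact hw
    · show (z : K) ∈ C j
      rw [← z.2.choose_spec]
      exact (hC j _).2 hxj
  · intro x
    refine ⟨⟨e x, x, rfl⟩, ?_⟩
    exact hinj (Exists.choose_spec (⟨x, rfl⟩ : ∃ y, e y = e x))

lemma sigma_of_polish {X : Type*} [TopologicalSpace X] [CompletelyRegularSpace X]
    (hX : Cosmic X) (φ : (ℕ → ℕ) → (X → ℝ)) (hφ : Monotone φ)
    (hd : ∀ f : X → ℝ, Continuous f → ∃ α : ℕ → ℕ, f ≤ φ α)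
    {Z : Type*} [tZ : TopologicalSpace Z] [PolishSpace Z] (p : Z → X) (hp : Continuous p)
    (hps : Function.Surjective p) : SigmaCompactSpace X := by
  letI := TopologicalSpace.upgradeIsCompletelyMetrizable Z
  let S : Set (Set Z) := {V | IsOpen V ∧ ∃ A : Set X, IsSigmaCompact A ∧ p '' V ⊆ A}
  obtain ⟨T, hTc, hTS, hT⟩ := TopologicalSpace.isOpen_sUnion_countable S (fun V hV => hV.1)
  have hsmall : ∃ A : Set X, IsSigmaCompact A ∧ p '' (⋃₀ S) ⊆ A := by
    rw [← hT]
    have h1 : ∀ V : T, ∃ A : Set X, IsSigmaCompact A ∧ p '' V ⊆ A := fun V => (hTS V.2).2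
    choose A hA hVA using h1
    have := hTc.to_subtype
    refine ⟨⋃ V, A V, isSigmaCompact_iUnion _ hA, ?_⟩
    rintro _ ⟨z, ⟨V, hV, hz⟩, rfl⟩
    exact mem_iUnion.2 ⟨⟨V, hV⟩, hVA ⟨V, hV⟩ ⟨z, hz, rfl⟩⟩
  obtain ⟨A0, hA0, hpA0⟩ := hsmall
  by_cases hall : ⋃₀ S = univ
  · rw [← isSigmaCompact_univ_iff]
    have : A0 = univ := by
      refine eq_univ_of_forall fun x => ?_
      obtain ⟨z, rfl⟩ := hps x
      exact hpA0 ⟨z, by rw [hall]; exact mem_univ z, rfl⟩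
    rwa [← this]
  exfalso
  have hC : ∃ z0, z0 ∉ ⋃₀ S := by
    by_contra h
    push Not at h
    exact hall (eq_univ_of_forall h)
  obtain ⟨z0, hz0⟩ := hC
  have hunb : ∀ V : Set Z, IsOpen V → (∃ z ∈ V, z ∉ ⋃₀ S) → ∃ h : X → ℝ, Continuous h ∧
      ∀ M : ℝ, ∃ z ∈ V, z ∉ ⋃₀ S ∧ M < h (p z) := by
    rintro V hV ⟨z, hzV, hz⟩
    by_contra hcon
    push Not at hcon
    have hcomp := bounded_compact hX (p '' (V \ ⋃₀ S)) (by
      intro h hh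
      obtain ⟨M, hM⟩ := hcon h hh
      refine ⟨M, ?_⟩
      rintro _ ⟨w, ⟨hw1, hw2⟩, rfl⟩
      exact hM w hw1 hw2)
    apply hz
    refine ⟨V, ⟨hV, closure (p '' (V \ ⋃₀ S)) ∪ A0, ?_, ?_⟩, hzV⟩
    · rw [union_eq_iUnion]
      refine isSigmaCompact_iUnion _ ?_
      rintro (_ | _)
      · exact hA0
      · exact hcomp.isSigmaCompact
    · rintro _ ⟨w, hw, rfl⟩
      by_cases hwS : w ∈ ⋃₀ S
      · exact Or.inr (hpA0 ⟨w, hwS, rfl⟩)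
      · exact Or.inl (subset_closure ⟨w, ⟨hw, hwS⟩, rfl⟩)
  let Q := {q : List ℕ × Set X × Z × ℝ // IsOpen q.2.1 ∧ Good φ q.1 q.2.1 ∧ q.2.2.1 ∉ ⋃₀ S ∧
    0 < q.2.2.2 ∧ p '' Metric.closedBall q.2.2.1 q.2.2.2 ⊆ q.2.1}
  have hstep : ∀ q : Q, ∃ q' : Q, (∃ i, q'.1.1 = i :: q.1.1) ∧
      Metric.closedBall q'.1.2.2.1 q'.1.2.2.2 ⊆ Metric.closedBall q.1.2.2.1 q.1.2.2.2 ∧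
      q'.1.2.2.2 ≤ q.1.2.2.2 / 2 := by
    rintro ⟨⟨l, W, z, r⟩, hWo, hW, hz, hr, hball⟩
    dsimp only at hWo hW hz hr hball ⊢
    obtain ⟨h, hh, hM⟩ := hunb (Metric.ball z r) Metric.isOpen_ball ⟨z, Metric.mem_ball_self hr, hz⟩
    obtain ⟨i, hi⟩ := Good.step φ l W hW h hh
    obtain ⟨z', hz'b, hz', hiz⟩ := hM i
    have hW'o : IsOpen (W ∩ {x | (i : ℝ) < h x}) := hWo.inter (isOpen_lt continuous_const hh)
    have hopen : IsOpen (Metric.ball z r ∩ p ⁻¹' (W ∩ {x | (i : ℝ) < h x})) :=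
      Metric.isOpen_ball.inter (hW'o.preimage hp)
    have hmem : z' ∈ Metric.ball z r ∩ p ⁻¹' (W ∩ {x | (i : ℝ) < h x}) :=
      ⟨hz'b, hball ⟨z', Metric.ball_subset_closedBall hz'b, rfl⟩, hiz⟩
    obtain ⟨ε, hε, hεs⟩ := Metric.nhds_basis_closedBall.mem_iff.1 (hopen.mem_nhds hmem)
    have hsub := (Metric.closedBall_subset_closedBall (x := z') (min_le_left ε (r / 2))).trans hεs
    refine ⟨⟨(i :: l, W ∩ {x | (i : ℝ) < h x}, z', min ε (r / 2)), hW'o, hi, hz',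
      lt_min hε (by linarith), ?_⟩, ⟨i, rfl⟩, ?_, min_le_right _ _⟩
    · rintro _ ⟨w, hw, rfl⟩
      exact (hsub hw).2
    · exact fun w hw => Metric.ball_subset_closedBall (hsub hw).1
  choose nx hnx1 hnx2 hnx3 using hstep
  let q0 : Q := ⟨([], univ, z0, 1), isOpen_univ, by
    intro f hf _ _
    obtain ⟨α, hα⟩ := hd f hf
    exact ⟨α, trivial, hα⟩, hz0, one_pos, subset_univ _⟩
  let q : ℕ → Q := fun n => nx^[n] q0
  have hq : ∀ n, q (n + 1) = nx (q n) := fun n => Function.iterate_succ_apply' nx n q0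
  choose a ha using fun n => hnx1 (q n)
  have hpre : ∀ n, (q n).1.1 = pre a n := by
    intro n
    induction n with
    | zero => rfl
    | succ n ih => rw [hq, ha, ih]; rfl
  have hrad : ∀ n, (q n).1.2.2.2 ≤ (1 / 2 : ℝ) ^ n := by
    intro n
    induction n with
    | zero => simp [q, q0]
    | succ n ih =>
      rw [hq, pow_succ]
      have := hnx3 (q n)
      linarith
  have hanti : Antitone fun n => Metric.closedBall (q n).1.2.2.1 (q n).1.2.2.2 := by
    refine antitone_nat_of_succ_le fun n => ?_
    rw [hq]
    exact hnx2 (q n)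
  have hcen : ∀ n, (q n).1.2.2.1 ∈ Metric.closedBall (q n).1.2.2.1 (q n).1.2.2.2 := fun n =>
    Metric.mem_closedBall_self (q n).2.2.2.2.1.le
  have hcau : CauchySeq fun n => (q n).1.2.2.1 := by
    refine cauchySeq_of_le_tendsto_0' (fun n => (1 / 2 : ℝ) ^ n) ?_
      (tendsto_pow_atTop_nhds_zero_of_lt_one (by norm_num) (by norm_num))
    intro n m hnm
    rw [dist_comm]
    exact (Metric.mem_closedBall.1 (hanti hnm (hcen m))).trans (hrad n)
  obtain ⟨z, hz⟩ := cauchySeq_tendsto_of_complete hcau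
  have hzn : ∀ n, z ∈ Metric.closedBall (q n).1.2.2.1 (q n).1.2.2.2 := by
    intro n
    refine Metric.isClosed_closedBall.mem_of_tendsto hz ?_
    filter_upwards [eventually_ge_atTop n] with m hm
    exact hanti hm (hcen m)
  refine Good.contra hφ a (fun n => (q n).1.2.1) (fun n => (q n).2.1) (fun n => ?_) (p z)
    (fun n => (q n).2.2.2.2.2 ⟨z, hzn n, rfl⟩)
  rw [← hpre]
  exact (q n).2.2.1

end GB

/-- Assume `ω₁ < 𝔟`. If the finest compatible uniformity of a completely regular
Hausdorff space `X` has a `𝔊`-base and the set `C(X)` of continuous real functions is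
`ω^ω`-dominated in `ℝ^X`, then `X` is cosmic and σ-compact. -/
theorem cosmic_sigmaCompact_of_gBase_dominated
    {X : Type*} [t : TopologicalSpace X] [CompletelyRegularSpace X] [T2Space X]
    (hb : ∀ B : Set (ℕ → ℕ), Cardinal.mk ↥B ≤ Cardinal.aleph 1 →
      ∃ C : Set (ℕ → ℕ), C.Countable ∧ ∀ f ∈ B, ∃ g ∈ C, f ≤ g)
    (hfine : ∃ u : UniformSpace X, u.toTopologicalSpace = t ∧
      (∀ d : X → X → ℝ, (∀ x, d x x = 0) → (∀ x y, d x y = d y x) →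
        (∀ x y z, d x z ≤ d x y + d y z) →
        Continuous (fun p : X × X => d p.1 p.2) →
        ∀ ε : ℝ, 0 < ε → {p : X × X | d p.1 p.2 < ε} ∈ @uniformity X u) ∧
      ∃ U : (ℕ → ℕ) → Set (X × X), (∀ α, U α ∈ @uniformity X u) ∧
        (∀ V ∈ @uniformity X u, ∃ α, U α ⊆ V) ∧
        ∀ α β : ℕ → ℕ, α ≤ β → U β ⊆ U α)
    (hdom : ∃ φ : (ℕ → ℕ) → (X → ℝ), Monotone φ ∧
      ∀ f : X → ℝ, Continuous f → ∃ α : ℕ → ℕ, f ≤ φ α) :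
    Cosmic X ∧ SigmaCompactSpace X := by
  obtain ⟨u, rfl, hfine, U, hU, hUb, hUm⟩ := hfine
  obtain ⟨φ, hφ, hd⟩ := hdom
  obtain ⟨S, hS, hSd⟩ := GB.exists_dense hb U hU hUb hUm φ hφ hd
  have hX : Cosmic X := by
    refine GB.cosmic_aux ?_ U hU hUb hUm φ hφ hd S hS hSd
    intro f hf ε hε
    refine hfine (fun x y => |f x - f y|) (fun x => by simp) (fun x y => abs_sub_comm _ _)
      (fun x y z => abs_sub_le _ _ _) ?_ ε hε
    exact ((hf.comp continuous_fst).sub (hf.comp continuous_snd)).abs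
  refine ⟨hX, ?_⟩
  by_cases hne : Nonempty X
  · obtain ⟨Z, tZ, hZ, p, hp, hps⟩ := GB.exists_polish hX φ hφ hd
    exact GB.sigma_of_polish hX φ hφ hd p hp hps
  · have : IsEmpty X := not_nonempty_iff.1 hne
    infer_instance
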